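/- arXiv:1905.00712 — 2 statements merged into one kernel-verified Lean document; each statement's English description precedes it below -/
import Mathlib

section
/- For every natural number l ≥ 1 and all real numbers λ, μ with λ ≠ η_l, the determinant of M_l(λ,μ) vanishes if and only if μ = (P_l − ξ_l·λ)/(η_l − λ). -/
/-- The matrix `M_l(λ,μ)` from Theorem `fundamental-2` of the paper, for the
multi-parameter biharmonic Steklov problems with `σ = 0` on the unit ball of `ℝ^N`. -/
noncomputable def steklovMatrix (N l : ℕ) (lam mu : ℝ) : Matrix (Fin 2) (Fin 2) ℝ :=
  !![(l : ℝ) * ((l : ℝ) - 1 - lam), ((l : ℝ) + 2) * ((l : ℝ) + 1 - lam);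
     (l : ℝ) * ((l : ℝ) + (N : ℝ) - 2) * ((l : ℝ) - 1) - mu,
     (l : ℝ) * ((l : ℝ) * ((l : ℝ) - 5) + (N : ℝ) * ((l : ℝ) - 1) - 2) - mu]

/-- `ξ_l`, the NBS eigenvalue on the unit ball associated with degree `l`. -/
noncomputable def xiBall (N l : ℕ) : ℝ :=
  (l : ℝ) * (2 * (l : ℝ) ^ 2 + ((N : ℝ) - 1) * (l : ℝ) - (N : ℝ) + 2)

/-- `η_l`, the DBS eigenvalue on the unit ball associated with degree `l`. -/
noncomputable def etaBall (l : ℕ) : ℝ := 2 * (l : ℝ) + 1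

/-- `P_l := 3l⁴ + 2(N−2)l³ − (N+1)l² − (N−2)l`. -/
noncomputable def PBall (N l : ℕ) : ℝ :=
  3 * (l : ℝ) ^ 4 + 2 * ((N : ℝ) - 2) * (l : ℝ) ^ 3 - ((N : ℝ) + 1) * (l : ℝ) ^ 2
    - ((N : ℝ) - 2) * (l : ℝ)

/-- The determinant of `M_l(λ,μ)` in terms of `η_l`, `ξ_l` and `P_l`. -/
theorem det_steklovMatrix (N l : ℕ) (lam mu : ℝ) :
    (steklovMatrix N l lam mu).det =
      2 * (mu * (etaBall l - lam) - (PBall N l - xiBall N l * lam)) := by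
  rw [steklovMatrix, Matrix.det_fin_two_of, etaBall, PBall, xiBall]
  ring

/-- For `l ≥ 1` and `λ ≠ η_l`, the determinant of `M_l(λ,μ)` vanishes iff
`μ = (P_l − ξ_l λ)/(η_l − λ)`. -/
theorem det_steklovMatrix_eq_zero_iff_mu_eq (N : ℕ) (hN : 2 ≤ N) (l : ℕ) (hl : 1 ≤ l)
    (lam mu : ℝ) (hlam : lam ≠ etaBall l) :
    (steklovMatrix N l lam mu).det = 0 ↔
      mu = (PBall N l - xiBall N l * lam) / (etaBall l - lam) := by
  rw [det_steklovMatrix, eq_div_iff (sub_ne_zero.mpr hlam.symm), mul_eq_zero_iff_left two_ne_zero,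
    sub_eq_zero]
end

section
/- For every fixed real μ < 0, the sequence of (BS_μ) eigenvalues on the unit ball, λ_j(μ) := η_{ℓ(j)} + ℓ(j)²(ℓ(j)+2)² / (μ − ξ_{ℓ(j)}), satisfies the Weyl-type asymptotic law lim_{j→∞} λ_j(μ) / j^{1/(N−1)} = (3/4) · 2^{(N−2)/(N−1)} ((N−1)!)^{1/(N−1)}. -/
/-- `D_N(ℓ) = (2ℓ+N−1)(N+ℓ−2)!/(ℓ!(N−1)!)`, the dimension of the space of spherical
harmonics of degree at most `ℓ` in `ℝ^N` (as a real number). -/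
noncomputable def harmDim (N l : ℕ) : ℝ :=
  (2 * (l : ℝ) + (N : ℝ) - 1) * (Nat.factorial (N + l - 2) : ℝ) /
    ((Nat.factorial l : ℝ) * (Nat.factorial (N - 1) : ℝ))

/-- `L : ℕ → ℕ` assigns to each index `j ≥ 1` the unique degree `ℓ(j)` with
`D_N(ℓ(j)−1) < j ≤ D_N(ℓ(j))` (with the convention `D_N(−1) = 0`, i.e. all lower
degrees `m < ℓ(j)` satisfy `D_N(m) < j`). -/
def IsDegreeCount (N : ℕ) (L : ℕ → ℕ) : Prop :=
  ∀ j : ℕ, 1 ≤ j → (j : ℝ) ≤ harmDim N (L j) ∧ ∀ m : ℕ, m < L j → harmDim N m < (j : ℝ)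

open Filter Topology

theorem tendsto_add_const_div_self (a : ℝ) :
    Tendsto (fun l : ℕ => ((l : ℝ) + a) / (l : ℝ)) atTop (𝓝 1) := by
  have h : Tendsto (fun l : ℕ => 1 + a / (l : ℝ)) atTop (𝓝 (1 + 0)) :=
    (tendsto_const_div_atTop_nhds_zero_nat a).const_add 1
  rw [add_zero] at h
  refine h.congr' ?_
  filter_upwards [eventually_gt_atTop 0] with l hl
  have : (l : ℝ) ≠ 0 := by positivity
  field_simp

theorem tendsto_factorial_add_div (n : ℕ) :
    Tendsto (fun l : ℕ => (Nat.factorial (l + n) : ℝ) / ((Nat.factorial l : ℝ) * (l : ℝ) ^ n))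
      atTop (𝓝 1) := by
  induction n with
  | zero =>
    refine tendsto_const_nhds.congr fun l => ?_
    have : (Nat.factorial l : ℝ) ≠ 0 := by positivity
    simp [this]
  | succ n ih =>
    have h := (tendsto_add_const_div_self ((n : ℝ) + 1)).mul ih
    rw [mul_one] at h
    refine h.congr fun l => ?_
    rw [← add_assoc, ← add_assoc l n 1, Nat.factorial_succ, pow_succ, div_mul_div_comm]
    push_cast
    congr 1; ring

theorem tendsto_harmDim_div_pow (n : ℕ) :
    Tendsto (fun l : ℕ => harmDim (n + 2) l / (l : ℝ) ^ (n + 1)) atTop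
      (𝓝 (2 / (Nat.factorial (n + 1) : ℝ))) := by
  have h := ((tendsto_add_const_div_self (((n : ℝ) + 1) / 2)).mul
    (tendsto_factorial_add_div n)).mul_const (2 / (Nat.factorial (n + 1) : ℝ))
  simp only [mul_one, one_mul] at h
  refine h.congr fun l => ?_
  have e : n + 2 + l - 2 = l + n := by omega
  rw [harmDim, e, show n + 2 - 1 = n + 1 from rfl, div_mul_div_comm, div_mul_div_comm, div_div]
  push_cast
  congr 1 <;> ring

theorem tendsto_harmDim_pred_div_pow (n : ℕ) :
    Tendsto (fun l : ℕ => harmDim (n + 2) (l - 1) / (l : ℝ) ^ (n + 1)) atTop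
      (𝓝 (2 / (Nat.factorial (n + 1) : ℝ))) := by
  rw [← tendsto_add_atTop_iff_nat 1]
  have h := (tendsto_harmDim_div_pow n).div ((tendsto_add_const_div_self 1).pow (n + 1))
    (by simp)
  simp only [one_pow, div_one] at h
  refine h.congr' ?_
  filter_upwards [eventually_gt_atTop 0] with l hl
  have : (l : ℝ) ≠ 0 := by positivity
  simp only [Pi.div_apply, add_tsub_cancel_right]
  push_cast
  rw [div_pow, div_div_div_cancel_right₀ (by positivity)]

theorem IsDegreeCount.tendsto_atTop {N : ℕ} {L : ℕ → ℕ} (hL : IsDegreeCount N L) :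
    Tendsto L atTop atTop := by
  rw [Filter.tendsto_atTop]
  intro M
  have h : ∀ᶠ j : ℕ in atTop, ∀ m ∈ Finset.range M, harmDim N m < (j : ℝ) := by
    rw [Finset.eventually_all]
    exact fun m _ => tendsto_natCast_atTop_atTop.eventually_gt_atTop _
  filter_upwards [h, eventually_ge_atTop 1] with j hj hj1
  by_contra! hlt
  exact absurd (hL j hj1).1 (not_le.2 (hj _ (Finset.mem_range.2 hlt)))

theorem IsDegreeCount.tendsto_div_pow {n : ℕ} {L : ℕ → ℕ} (hL : IsDegreeCount (n + 2) L) :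
    Tendsto (fun j : ℕ => (j : ℝ) / (L j : ℝ) ^ (n + 1)) atTop
      (𝓝 (2 / (Nat.factorial (n + 1) : ℝ))) := by
  have hT := hL.tendsto_atTop
  refine tendsto_of_tendsto_of_tendsto_of_le_of_le'
    ((tendsto_harmDim_pred_div_pow n).comp hT) ((tendsto_harmDim_div_pow n).comp hT) ?_ ?_
  · filter_upwards [eventually_ge_atTop 1, hT.eventually_gt_atTop 0] with j hj hLj
    exact div_le_div_of_nonneg_right ((hL j hj).2 _ (by omega)).le (by positivity)
  · filter_upwards [eventually_ge_atTop 1] with j hj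
    exact div_le_div_of_nonneg_right (hL j hj).1 (by positivity)

theorem tendsto_eigenvalue_div_self (N : ℕ) (mu : ℝ) :
    Tendsto (fun l : ℕ =>
        (etaBall l + (l : ℝ) ^ 2 * ((l : ℝ) + 2) ^ 2 / (mu - xiBall N l)) / (l : ℝ))
      atTop (𝓝 (3 / 2)) := by
  have hinv : Tendsto (fun l : ℕ => ((l : ℝ))⁻¹) atTop (𝓝 0) :=
    tendsto_inv_atTop_nhds_zero_nat
  have hcont : ContinuousAt (fun x : ℝ => 2 + x + (1 + 2 * x) ^ 2 /
      (mu * x ^ 3 - (2 + ((N : ℝ) - 1) * x - ((N : ℝ) - 2) * x ^ 2))) 0 := by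
    refine ContinuousAt.add (by fun_prop) (ContinuousAt.div (by fun_prop) (by fun_prop) ?_)
    norm_num
  have h := hcont.tendsto.comp hinv
  have e : (2 : ℝ) + 0 + (1 + 2 * 0) ^ 2 /
      (mu * 0 ^ 3 - (2 + ((N : ℝ) - 1) * 0 - ((N : ℝ) - 2) * 0 ^ 2)) = 3 / 2 := by norm_num
  rw [e] at h
  refine h.congr' ?_
  filter_upwards [eventually_gt_atTop 0] with l hl
  have hl' : (l : ℝ) ≠ 0 := by positivity
  have hden : mu - xiBall N l = (l : ℝ) ^ 3 * (mu * ((l : ℝ)⁻¹) ^ 3 -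
      (2 + ((N : ℝ) - 1) * (l : ℝ)⁻¹ - ((N : ℝ) - 2) * ((l : ℝ)⁻¹) ^ 2)) := by
    rw [xiBall]
    field_simp
    ring
  have hnum : (l : ℝ) ^ 2 * ((l : ℝ) + 2) ^ 2 =
      (l : ℝ) ^ 3 * ((l : ℝ) * (1 + 2 * (l : ℝ)⁻¹) ^ 2) := by
    field_simp
  rw [hden, hnum, mul_div_mul_left _ _ (pow_ne_zero 3 hl'), mul_div_assoc, add_div,
    mul_div_cancel_left₀ _ hl', etaBall, add_div, mul_div_cancel_right₀ _ hl', one_div]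
  rfl

/-- Weyl-type law for the (BS_μ) eigenvalues on the unit ball, for fixed `μ < 0`:
`λ_j(μ) = η_{ℓ(j)} + ℓ(j)²(ℓ(j)+2)²/(μ − ξ_{ℓ(j)})` satisfies
`λ_j(μ) / j^{1/(N−1)} → (3/4)·2^{(N−2)/(N−1)} ((N−1)!)^{1/(N−1)}` as `j → ∞`. -/
theorem BSmu_weyl_asymptotics (N : ℕ) (hN : 2 ≤ N) (L : ℕ → ℕ)
    (hL : IsDegreeCount N L) (mu : ℝ) (hmu : mu < 0) :
    Tendsto (fun j : ℕ =>
        (etaBall (L j) +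
          (L j : ℝ) ^ 2 * ((L j : ℝ) + 2) ^ 2 / (mu - xiBall N (L j))) /
          (j : ℝ) ^ ((1 : ℝ) / ((N : ℝ) - 1)))
      atTop
      (𝓝 ((3 / 4 : ℝ) * (2 : ℝ) ^ (((N : ℝ) - 2) / ((N : ℝ) - 1)) *
        (Nat.factorial (N - 1) : ℝ) ^ ((1 : ℝ) / ((N : ℝ) - 1)))) := by
  obtain ⟨n, rfl⟩ : ∃ n, N = n + 2 := ⟨N - 2, by omega⟩
  have hT := hL.tendsto_atTop
  set p : ℝ := 1 / (((n + 2 : ℕ) : ℝ) - 1) with hp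
  have hp' : p = ((n + 1 : ℕ) : ℝ)⁻¹ := by
    rw [hp, one_div]
    push_cast
    congr 1
    ring
  have hf : (0 : ℝ) < (Nat.factorial (n + 1) : ℝ) := by positivity
  have hroot : Tendsto (fun j : ℕ => (j : ℝ) ^ p / (L j : ℝ)) atTop
      (𝓝 ((2 / (Nat.factorial (n + 1) : ℝ)) ^ p)) := by
    refine (hL.tendsto_div_pow.rpow_const (p := p) (Or.inl (by positivity))).congr fun j => ?_
    rw [Real.div_rpow (by positivity) (by positivity), hp',
      Real.pow_rpow_inv_natCast (by positivity) n.succ_ne_zero]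
  have h := ((tendsto_eigenvalue_div_self (n + 2) mu).comp hT).div hroot (by positivity)
  have hlim : (3 / 4 : ℝ) * (2 : ℝ) ^ ((((n + 2 : ℕ) : ℝ) - 2) / (((n + 2 : ℕ) : ℝ) - 1)) *
      (Nat.factorial (n + 2 - 1) : ℝ) ^ p =
      3 / 2 / (2 / (Nat.factorial (n + 1) : ℝ)) ^ p := by
    have hexp : (((n + 2 : ℕ) : ℝ) - 2) / (((n + 2 : ℕ) : ℝ) - 1) = 1 - p := by
      have : ((n + 2 : ℕ) : ℝ) - 1 ≠ 0 := by
        push_cast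
        have : (0 : ℝ) ≤ n := n.cast_nonneg
        linarith
      rw [hp, div_eq_iff this, sub_mul, div_mul_cancel₀ _ this]
      ring
    rw [hexp, Real.rpow_sub two_pos, Real.rpow_one, Real.div_rpow two_pos.le hf.le,
      show n + 2 - 1 = n + 1 from rfl]
    field_simp
    norm_num
  rw [hlim]
  refine h.congr' ?_
  filter_upwards [hT.eventually_gt_atTop 0] with j hj
  have : (L j : ℝ) ≠ 0 := by positivity
  exact div_div_div_cancel_right₀ this _ _
end
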